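/- arXiv:2102.03030 — 11 statements merged into one kernel-verified Lean document; each statement's English description precedes it below -/
import Mathlib

section
/- For every natural number n ≥ 1, the probabilities p_{k,n} sum to one: ∑_{k=1}^{n} k·(n-1)!/(n^k·(n-k)!) = 1. -/
open Finset

/-- Probability mass function of the Mlynar distribution with parameter `n`:
`p_{k,n} = k·(n-1)!/(n^k·(n-k)!)`. -/
noncomputable def mlynarP (n k : ℕ) : ℝ :=
  (k : ℝ) * (Nat.factorial (n - 1)) / ((n : ℝ) ^ k * (Nat.factorial (n - k)))

/-- For `k ≤ n`, the weight `mlynarP n k` is a difference of consecutive birthday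
probabilities `n.descFactorial k / n ^ k`. -/
theorem mlynarP_eq_sub {n k : ℕ} (hn : 1 ≤ n) (hk : k ≤ n) :
    mlynarP n k = (n.descFactorial k : ℝ) / (n : ℝ) ^ k
      - (n.descFactorial (k + 1) : ℝ) / (n : ℝ) ^ (k + 1) := by
  have hn0 : (n : ℝ) ≠ 0 := by positivity
  have hf : ((n - k).factorial : ℝ) ≠ 0 := by positivity
  have h1 : ((n - k).factorial : ℝ) * n.descFactorial k = n * (n - 1).factorial := by
    exact_mod_cast (Nat.factorial_mul_descFactorial hk).trans
      (Nat.mul_factorial_pred (by lia)).symm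
  rw [mlynarP, Nat.descFactorial_succ, Nat.cast_mul, Nat.cast_sub hk]
  field_simp
  linear_combination (-(k : ℝ) * (n : ℝ) ^ k) * h1

theorem mlynar_sum_eq_one (n : ℕ) (hn : 1 ≤ n) :
    ∑ k ∈ Finset.Icc 1 n, mlynarP n k = 1 := by
  have hsum : ∑ k ∈ Finset.range (n + 1), mlynarP n k = 1 := by
    rw [Finset.sum_congr rfl fun k hk ↦
      mlynarP_eq_sub hn (Nat.lt_succ_iff.mp (Finset.mem_range.mp hk)),
      Finset.sum_range_sub' fun k ↦ (n.descFactorial k : ℝ) / (n : ℝ) ^ k]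
    simp
  rw [Finset.range_eq_Ico, Finset.sum_eq_sum_Ico_succ_bot n.succ_pos] at hsum
  simpa [mlynarP, ← Finset.Ico_add_one_right_eq_Icc] using hsum
end

section
/- For every natural number n ≥ 1 and every integer χ with 0 ≤ χ ≤ n−1, the partial sums of the probabilities satisfy ∑_{i=1}^{χ} p_{i,n} = 1 − (n-1)!/(n^χ · (n-1-χ)!). -/
open Finset

theorem mlynar_cdf (n : ℕ) (hn : 1 ≤ n) (χ : ℕ) (hχ : χ ≤ n - 1) :
    ∑ i ∈ Finset.Icc 1 χ, mlynarP n i =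
      1 - (Nat.factorial (n - 1)) / ((n : ℝ) ^ χ * (Nat.factorial (n - 1 - χ))) := by
  induction χ with
  | zero =>
    have h : (Nat.factorial (n - 1) : ℝ) ≠ 0 := by positivity
    simp [h]
  | succ k ih =>
    obtain ⟨m, rfl⟩ : ∃ m, n = m + k + 2 := ⟨n - k - 2, by omega⟩
    rw [Finset.sum_Icc_succ_top (by omega), ih (by omega), mlynarP,
      show m + k + 2 - 1 - k = m + 1 by omega,
      show m + k + 2 - (k + 1) = m + 1 by omega,
      show m + k + 2 - 1 - (k + 1) = m by omega, Nat.factorial_succ m]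
    have hm : (Nat.factorial m : ℝ) ≠ 0 := by positivity
    have hm' : (m : ℝ) + 1 ≠ 0 := by positivity
    have hn' : (m : ℝ) + k + 2 ≠ 0 := by positivity
    push_cast
    field_simp
    ring
end

section
/- For every natural number n ≥ 1 and every k with 1 ≤ k ≤ n, the tail sum satisfies ∑_{i=k}^{n} p_{i,n} = (n-1)!/(n^{k-1} · (n-k)!). -/
open Finset

theorem mlynar_tail_sum (n : ℕ) (hn : 1 ≤ n) (k : ℕ) (hk1 : 1 ≤ k) (hkn : k ≤ n) :
    ∑ i ∈ Finset.Icc k n, mlynarP n i =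
      (Nat.factorial (n - 1)) / ((n : ℝ) ^ (k - 1) * (Nat.factorial (n - k))) := by
  have hn0 : (n : ℝ) ≠ 0 := by positivity
  obtain ⟨d, hd⟩ := Nat.exists_eq_add_of_le hkn
  induction d generalizing k with
  | zero =>
    obtain rfl : n = k := hd
    obtain ⟨m, rfl⟩ := Nat.exists_eq_add_of_le' hk1
    simp only [Icc_self, sum_singleton, mlynarP, Nat.add_sub_cancel, Nat.sub_self, pow_succ]
    field_simp
  | succ d ih =>
    rw [← add_sum_Ioc_eq_sum_Icc hkn, ← Icc_succ_left_eq_Ioc, Order.succ_eq_add_one,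
      ih (k + 1) (by omega) (by omega) (by omega), mlynarP]
    obtain ⟨m, rfl⟩ := Nat.exists_eq_add_of_le' hk1
    have h₁ : n - (m + 1) = d + 1 := by omega
    have h₂ : n - (m + 1 + 1) = d := by omega
    have hn' : (n : ℝ) = m + 1 + (d + 1) := by exact_mod_cast hd
    have hf : (d.factorial : ℝ) ≠ 0 := by positivity
    have hd1 : (d : ℝ) + 1 ≠ 0 := by positivity
    rw [h₁, h₂, Nat.factorial_succ, Nat.add_sub_cancel, Nat.add_sub_cancel, pow_succ]
    push_cast
    field_simp
    linear_combination -hn'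
end

section
/- For every natural number n ≥ 1, the expected gain g(n) = ∑_{k=1}^{n} k · p_{k,n} admits the closed finite-sum form g(n) = (n-1)! · n^{1-n} · ∑_{j=0}^{n-1} n^j / j!. -/
open Finset Real Filter

theorem sum_range_sub_sq_mul_pow_div_factorial (x : ℝ) (m : ℕ) :
    ∑ j ∈ Finset.range m, (x - j) ^ 2 * (x ^ j / (Nat.factorial j)) =
      x * ∑ j ∈ Finset.range m, x ^ j / (Nat.factorial j) +
        (x - m) * m * (x ^ m / (Nat.factorial m)) := by
  induction m with
  | zero => simp
  | succ m ih =>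
    rw [Finset.sum_range_succ, Finset.sum_range_succ, ih, Nat.factorial_succ]
    push_cast
    field_simp
    ring

theorem mul_mlynarP_sub {n j : ℕ} (hj : j < n) :
    ((n - j : ℕ) : ℝ) * mlynarP n (n - j) =
      (Nat.factorial (n - 1)) / (n : ℝ) ^ n *
        (((n : ℝ) - j) ^ 2 * ((n : ℝ) ^ j / (Nat.factorial j))) := by
  have hn : (n : ℝ) ≠ 0 := Nat.cast_ne_zero.mpr (by lia)
  have hpow : (n : ℝ) ^ n = (n : ℝ) ^ (n - j) * (n : ℝ) ^ j := by
    rw [← pow_add, Nat.sub_add_cancel hj.le]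
  rw [mlynarP, Nat.sub_sub_self hj.le, hpow, Nat.cast_sub hj.le]
  field_simp

theorem mlynar_expectation_closed_form (n : ℕ) (hn : 1 ≤ n) :
    ∑ k ∈ Finset.Icc 1 n, (k : ℝ) * mlynarP n k =
      (Nat.factorial (n - 1)) * (n : ℝ) ^ ((1 : ℤ) - (n : ℤ)) *
        ∑ j ∈ Finset.range n, (n : ℝ) ^ j / (Nat.factorial j) := by
  have hn0 : (n : ℝ) ≠ 0 := Nat.cast_ne_zero.mpr (by lia)
  have hreflect : ∑ k ∈ Finset.Icc 1 n, (k : ℝ) * mlynarP n k =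
      ∑ j ∈ Finset.range n, ((n - j : ℕ) : ℝ) * mlynarP n (n - j) := by
    refine Finset.sum_nbij' (fun k => n - k) (fun j => n - j) ?_ ?_ ?_ ?_ ?_ <;>
      intro k hk <;> simp only [Finset.mem_Icc, Finset.mem_range] at hk ⊢
    any_goals lia
    rw [Nat.sub_sub_self hk.2]
  rw [hreflect, Finset.sum_congr rfl fun j hj => mul_mlynarP_sub (Finset.mem_range.mp hj),
    ← Finset.mul_sum, sum_range_sub_sq_mul_pow_div_factorial, zpow_sub₀ hn0, zpow_one,
    zpow_natCast]
  ring
end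

section
/- The scaled expected gain h(n) = g(n)/√n converges: lim_{n→∞} (1/√n) · ∑_{k=1}^{n} k · p_{k,n} = √(π/2). -/
open Finset Real Filter

open MeasureTheory Topology

/-- The integer-exponent form of the Laplace transform of a power. -/
lemma integral_pow_mul_exp_neg_mul_Ioi (k : ℕ) {s : ℝ} (hs : 0 < s) :
    ∫ x in Set.Ioi (0 : ℝ), x ^ k * exp (-(s * x)) = k.factorial / s ^ (k + 1) := by
  have h := Real.integral_rpow_mul_exp_neg_mul_Ioi (a := (k : ℝ) + 1) (r := s) (by positivity) hs
  rw [Real.Gamma_nat_eq_factorial] at h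
  have e : (k : ℝ) + 1 = ((k + 1 : ℕ) : ℝ) := by push_cast; ring
  rw [add_sub_cancel_right, e, Real.rpow_natCast] at h
  simp only [Real.rpow_natCast] at h
  rw [h, one_div, inv_pow]
  ring

lemma integrableOn_pow_mul_exp_neg_mul_Ioi (k : ℕ) {s : ℝ} (hs : 0 < s) :
    IntegrableOn (fun x : ℝ => x ^ k * exp (-(s * x))) (Set.Ioi 0) := by
  have h := integrableOn_rpow_mul_exp_neg_mul_rpow (p := 1) (s := k) (b := s)
    (by linarith [k.cast_nonneg (α := ℝ)]) one_pos hs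
  simpa [neg_mul] using h

/-- The telescoped form of the expected gain. -/
lemma sum_mul_mlynarP {n : ℕ} (hn : n ≠ 0) :
    ∑ k ∈ Finset.Icc 1 n, (k : ℝ) * mlynarP n k =
      ∑ k ∈ Finset.range (n + 1), (n.descFactorial k : ℝ) / (n : ℝ) ^ k - 1 := by
  have hn' : (n : ℝ) ≠ 0 := by exact_mod_cast hn
  have hP : ∀ k ≤ n, mlynarP n k = (n.descFactorial k : ℝ) / (n : ℝ) ^ k * (k / n) := by
    intro k hk
    have h1 : ((n - k).factorial : ℝ) * n.descFactorial k = n * (n - 1).factorial := by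
      exact_mod_cast (Nat.factorial_mul_descFactorial hk).trans (Nat.mul_factorial_pred hn).symm
    have h2 : ((n - k).factorial : ℝ) ≠ 0 := by positivity
    rw [mlynarP]
    field_simp
    linear_combination -(k : ℝ) * h1
  have key : ∀ m ≤ n, ∑ k ∈ Finset.Icc 1 m, (k : ℝ) * mlynarP n k =
      ∑ k ∈ Finset.range (m + 1), (n.descFactorial k : ℝ) / (n : ℝ) ^ k - 1
        - m * ((n.descFactorial (m + 1) : ℝ) / (n : ℝ) ^ (m + 1)) := by
    intro m
    induction m with
    | zero => simp
    | succ m ih =>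
      intro hm
      rw [Finset.sum_Icc_succ_top (by omega), ih (by omega), Finset.sum_range_succ _ (m + 1),
        hP _ hm, Nat.descFactorial_succ n (m + 1), Nat.cast_mul, Nat.cast_sub hm, pow_succ _ (m + 1)]
      push_cast
      field_simp
      ring
  rw [key n le_rfl]
  simp

lemma integral_one_add_div_pow_mul_exp {n : ℕ} (hn : n ≠ 0) :
    ∫ x in Set.Ioi (0 : ℝ), (1 + x / √n) ^ n * exp (-(√n * x)) =
      1 / √n * ∑ k ∈ Finset.range (n + 1), (n.descFactorial k : ℝ) / (n : ℝ) ^ k := by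
  have hs : 0 < √(n : ℝ) := by positivity
  have e : ∀ x : ℝ, (1 + x / √n) ^ n * exp (-(√n * x)) =
      ∑ k ∈ Finset.range (n + 1), (n.choose k / √n ^ k) * (x ^ k * exp (-(√n * x))) := by
    intro x
    rw [add_comm, add_pow, Finset.sum_mul]
    refine Finset.sum_congr rfl fun k _ => ?_
    rw [one_pow, div_pow]
    ring
  simp_rw [e]
  rw [integral_finsetSum _ fun k _ => (integrableOn_pow_mul_exp_neg_mul_Ioi k hs).const_mul _,
    Finset.mul_sum]
  refine Finset.sum_congr rfl fun k _ => ?_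
  rw [integral_const_mul, integral_pow_mul_exp_neg_mul_Ioi k hs,
    Nat.descFactorial_eq_factorial_mul_choose, Nat.cast_mul]
  have : (n : ℝ) ^ k = √(n : ℝ) ^ k * √(n : ℝ) ^ k := by
    rw [← mul_pow, Real.mul_self_sqrt n.cast_nonneg]
  rw [this]
  field_simp
  ring

lemma log_one_add_le {u : ℝ} (hu : 0 ≤ u) : log (1 + u) ≤ u - u ^ 2 / (2 * (1 + u)) := by
  have h := Real.self_le_sinh_iff.2 (Real.log_nonneg (by linarith : 1 ≤ 1 + u))
  rw [Real.sinh_log (by linarith)] at h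
  refine h.trans (le_of_eq ?_)
  field_simp
  ring

lemma sub_sq_div_two_le_log_one_add {u : ℝ} (hu : 0 ≤ u) : u - u ^ 2 / 2 ≤ log (1 + u) := by
  refine le_trans ?_ (Real.le_log_one_add_of_nonneg hu)
  rw [le_div_iff₀ (by linarith)]
  nlinarith [pow_nonneg hu 3]

lemma one_add_div_sqrt_pow_mul_exp_eq {n : ℕ} (hn : n ≠ 0) {x : ℝ} (hx : 0 ≤ x) :
    (1 + x / √n) ^ n * exp (-(√n * x)) = exp (n * (log (1 + x / √n) - x / √n)) := by
  have hs : 0 < √(n : ℝ) := by positivity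
  have h : 0 < 1 + x / √n := by positivity
  rw [← Real.exp_log (pow_pos h n), Real.log_pow, ← Real.exp_add]
  congr 1
  have : (n : ℝ) * (x / √n) = √n * x := by
    rw [mul_div_assoc', mul_comm, mul_div_assoc, Real.div_sqrt, mul_comm]
  linear_combination this

lemma one_add_div_sqrt_pow_mul_exp_le {n : ℕ} (hn : n ≠ 0) {x : ℝ} (hx : 0 ≤ x) :
    (1 + x / √n) ^ n * exp (-(√n * x)) ≤ exp (-(x ^ 2 / (2 * (1 + x / √n)))) := by
  have hs : 0 < √(n : ℝ) := by positivity
  rw [one_add_div_sqrt_pow_mul_exp_eq hn hx]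
  refine Real.exp_le_exp.2 ?_
  have h := mul_le_mul_of_nonneg_left (log_one_add_le (u := x / √n) (by positivity))
    (n.cast_nonneg (α := ℝ))
  have e : (n : ℝ) * ((x / √n) ^ 2 / (2 * (1 + x / √n))) = x ^ 2 / (2 * (1 + x / √n)) := by
    rw [div_pow, Real.sq_sqrt n.cast_nonneg]
    field_simp
  linarith

lemma exp_neg_sq_div_two_le {n : ℕ} (hn : n ≠ 0) {x : ℝ} (hx : 0 ≤ x) :
    exp (-(x ^ 2 / 2)) ≤ (1 + x / √n) ^ n * exp (-(√n * x)) := by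
  have hs : 0 < √(n : ℝ) := by positivity
  rw [one_add_div_sqrt_pow_mul_exp_eq hn hx]
  refine Real.exp_le_exp.2 ?_
  have h := mul_le_mul_of_nonneg_left
    (sub_sq_div_two_le_log_one_add (u := x / √n) (by positivity)) (n.cast_nonneg (α := ℝ))
  have e : (n : ℝ) * ((x / √n) ^ 2 / 2) = x ^ 2 / 2 := by
    rw [div_pow, Real.sq_sqrt n.cast_nonneg]
    field_simp
  linarith

lemma tendsto_sqrt_natCast_atTop : Tendsto (fun n : ℕ => √(n : ℝ)) atTop atTop :=
  Real.tendsto_sqrt_atTop.comp tendsto_natCast_atTop_atTop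

lemma tendsto_one_add_div_sqrt_pow_mul_exp {x : ℝ} (hx : 0 ≤ x) :
    Tendsto (fun n : ℕ => (1 + x / √n) ^ n * exp (-(√n * x))) atTop (𝓝 (exp (-(x ^ 2 / 2)))) := by
  have h0 : Tendsto (fun n : ℕ => x / √(n : ℝ)) atTop (𝓝 0) :=
    tendsto_sqrt_natCast_atTop.const_div_atTop x
  have h1 : Tendsto (fun n : ℕ => exp (-(x ^ 2 / (2 * (1 + x / √n))))) atTop
      (𝓝 (exp (-(x ^ 2 / (2 * (1 + 0)))))) :=
    (Real.continuous_exp.tendsto _).comp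
      ((tendsto_const_nhds.div ((h0.const_add 1).const_mul 2) (by norm_num)).neg)
  rw [add_zero, mul_one] at h1
  refine tendsto_of_tendsto_of_tendsto_of_le_of_le' tendsto_const_nhds h1 ?_ ?_
  · filter_upwards [eventually_ne_atTop 0] with n hn using exp_neg_sq_div_two_le hn hx
  · filter_upwards [eventually_ne_atTop 0] with n hn using one_add_div_sqrt_pow_mul_exp_le hn hx

lemma tendsto_integral_one_add_div_sqrt_pow_mul_exp :
    Tendsto (fun n : ℕ => ∫ x in Set.Ioi (0 : ℝ), (1 + x / √n) ^ n * exp (-(√n * x))) atTop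
      (𝓝 (√(π / 2))) := by
  have hG : ∫ x in Set.Ioi (0 : ℝ), exp (-(x ^ 2 / 2)) = √(π / 2) := by
    have h := integral_gaussian_Ioi (1 / 2)
    have e : √(π / (1 / 2)) / 2 = √(π / 2) := by
      rw [show π / (1 / 2) = 2 ^ 2 * (π / 2) by ring, Real.sqrt_mul (by positivity),
        Real.sqrt_sq (by norm_num)]
      ring
    rw [← e, ← h]
    congr 1 with x
    ring_nf
  rw [← hG]
  refine tendsto_integral_filter_of_dominated_convergence
    (fun x => exp (1 / 2) * exp (-(1 / 2) * x)) ?_ ?_ ?_ ?_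
  · exact Eventually.of_forall fun n => by fun_prop
  · filter_upwards [eventually_ne_atTop 0] with n hn
    filter_upwards [ae_restrict_mem measurableSet_Ioi] with x hx
    have hx' : 0 ≤ x := le_of_lt hx
    have hs : 1 ≤ √(n : ℝ) := Real.one_le_sqrt.2 (by exact_mod_cast Nat.one_le_iff_ne_zero.2 hn)
    rw [Real.norm_of_nonneg (by positivity), ← Real.exp_add]
    refine (one_add_div_sqrt_pow_mul_exp_le hn hx').trans (Real.exp_le_exp.2 ?_)
    have h1 : x ^ 2 / (2 * (1 + x)) ≤ x ^ 2 / (2 * (1 + x / √n)) := by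
      gcongr
      exact div_le_self hx' hs
    have h2 : (x - 1) / 2 ≤ x ^ 2 / (2 * (1 + x)) := by
      rw [div_le_div_iff₀ (by norm_num) (by positivity)]
      nlinarith
    linarith
  · exact (exp_neg_integrableOn_Ioi 0 (by norm_num : (0 : ℝ) < 1 / 2)).const_mul _
  · filter_upwards [ae_restrict_mem measurableSet_Ioi] with x hx
    exact tendsto_one_add_div_sqrt_pow_mul_exp (le_of_lt hx)

theorem mlynar_scaled_expectation_limit :
    Tendsto (fun n : ℕ => (1 / Real.sqrt n) * ∑ k ∈ Finset.Icc 1 n, (k : ℝ) * mlynarP n k)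
      atTop (nhds (Real.sqrt (π / 2))) := by
  have h := tendsto_integral_one_add_div_sqrt_pow_mul_exp.sub
    (tendsto_sqrt_natCast_atTop.const_div_atTop 1)
  rw [sub_zero] at h
  refine h.congr' ?_
  filter_upwards [eventually_ne_atTop 0] with n hn
  rw [integral_one_add_div_pow_mul_exp hn, sum_mul_mlynarP hn]
  ring
end

section
/- For every natural number n ≥ 1, the second moment of the Mlynar distribution satisfies ∑_{k=1}^{n} k² · p_{k,n} = 2n − ∑_{k=1}^{n} k · p_{k,n}. -/
open Finset Real Filter

theorem mlynarP_eq_descFactorial {n k : ℕ} (hn : 1 ≤ n) (hk : k ≤ n) :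
    mlynarP n k = k * (n.descFactorial k / (n : ℝ) ^ k) / n := by
  have hn0 : (n : ℝ) ≠ 0 := by positivity
  have hf : ((n - k).factorial : ℝ) ≠ 0 := by positivity
  have h₁ : ((n - k).factorial : ℝ) * n.descFactorial k = n.factorial := by
    exact_mod_cast Nat.factorial_mul_descFactorial hk
  have h₂ : (n : ℝ) * (n - 1).factorial = n.factorial := by
    exact_mod_cast Nat.mul_factorial_pred (by omega)
  unfold mlynarP
  field_simp
  linear_combination (k : ℝ) * (h₂ - h₁)

theorem descFactorial_succ_div_pow {n k : ℕ} (hn : 1 ≤ n) (hk : k ≤ n) :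
    (n.descFactorial (k + 1) / (n : ℝ) ^ (k + 1)) =
      (n.descFactorial k / (n : ℝ) ^ k) * (n - k) / n := by
  have hn0 : (n : ℝ) ≠ 0 := by positivity
  rw [Nat.descFactorial_succ]
  push_cast [hk]
  field_simp
  ring

theorem sum_range_mul_succ_mul_mlynarP {n m : ℕ} (hn : 1 ≤ n) (hm : m ≤ n + 1) :
    ∑ k ∈ Finset.range m, (k : ℝ) * (k + 1) * mlynarP n k =
      2 * n - (2 * n + m * (m - 1)) * (n.descFactorial m / (n : ℝ) ^ m) := by
  have hn0 : (n : ℝ) ≠ 0 := by positivity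
  induction m with
  | zero => simp
  | succ m ih =>
    rw [Finset.sum_range_succ, ih (by omega), mlynarP_eq_descFactorial hn (by omega),
      descFactorial_succ_div_pow hn (by omega)]
    generalize (n.descFactorial m / (n : ℝ) ^ m) = s
    push_cast
    field_simp
    ring

theorem mlynar_second_moment (n : ℕ) (hn : 1 ≤ n) :
    ∑ k ∈ Finset.Icc 1 n, (k : ℝ) ^ 2 * mlynarP n k =
      2 * n - ∑ k ∈ Finset.Icc 1 n, (k : ℝ) * mlynarP n k := by
  have h := sum_range_mul_succ_mul_mlynarP hn le_rfl
  rw [Nat.descFactorial_of_lt n.lt_succ_self, Finset.range_eq_Ico,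
    Finset.sum_eq_sum_Ico_succ_bot n.succ_pos] at h
  have hIcc : Finset.Ico (0 + 1) (n + 1) = Finset.Icc 1 n := by
    ext; simp
  rw [hIcc] at h
  rw [eq_sub_iff_add_eq, ← Finset.sum_add_distrib]
  simp only [Nat.cast_zero, zero_mul, zero_add, zero_div, mul_zero, sub_zero] at h
  rw [← h]
  exact Finset.sum_congr rfl fun k _ => by ring
end

section
/- For every natural number n ≥ 1, the variance of the Mlynar distribution satisfies Var(G_n) = ∑_{k=1}^{n} k²·p_{k,n} − (∑_{k=1}^{n} k·p_{k,n})² = 2n − g(n) − g(n)², where g(n) = ∑_{k=1}^{n} k·p_{k,n}. -/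
open Finset Real Filter

/-- The partial sums of `k (k + 1) p_{k,n}` telescope. -/
theorem sum_mul_succ_mul_mlynarP (n : ℕ) (hn : 1 ≤ n) (m : ℕ) (hm : m ≤ n) :
    ∑ k ∈ Finset.Icc 1 m, (k : ℝ) * (k + 1) * mlynarP n k =
      2 * n - (m * (m + 1) + 2 * n) * (n - m) * Nat.factorial (n - 1) /
        ((n : ℝ) ^ m * Nat.factorial (n - m)) := by
  have hn0 : (n : ℝ) ≠ 0 := by positivity
  induction m with
  | zero =>
    have hf : (Nat.factorial n : ℝ) = n * Nat.factorial (n - 1) := by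
      exact_mod_cast (Nat.mul_factorial_pred (by omega)).symm
    have h0 : (Nat.factorial (n - 1) : ℝ) ≠ 0 := by positivity
    simp only [Nat.sub_zero, hf]
    simp
    field_simp
    ring
  | succ m ih =>
    rw [Finset.sum_Icc_succ_top (by omega), ih (by omega), mlynarP]
    obtain ⟨d, hd⟩ := Nat.exists_eq_add_of_le hm
    have h1 : n - m = d + 1 := by omega
    have h2 : n - (m + 1) = d := by omega
    have hd' : (d : ℝ) = n - (m + 1) := by rw [hd]; push_cast; ring
    have hne : (n : ℝ) - m ≠ 0 := by
      have : (0 : ℝ) < d + 1 := by positivity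
      rw [hd'] at this
      linarith
    have hf : (Nat.factorial (d + 1) : ℝ) = (n - m) * Nat.factorial d := by
      rw [Nat.factorial_succ]
      push_cast
      rw [hd']
      ring
    have h0 : (Nat.factorial d : ℝ) ≠ 0 := by positivity
    rw [h1, h2, hf]
    push_cast
    field_simp
    ring

theorem mlynar_variance (n : ℕ) (hn : 1 ≤ n) :
    (∑ k ∈ Finset.Icc 1 n, (k : ℝ) ^ 2 * mlynarP n k) -
        (∑ k ∈ Finset.Icc 1 n, (k : ℝ) * mlynarP n k) ^ 2 =
      2 * n - (∑ k ∈ Finset.Icc 1 n, (k : ℝ) * mlynarP n k) -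
        (∑ k ∈ Finset.Icc 1 n, (k : ℝ) * mlynarP n k) ^ 2 := by
  have h := sum_mul_succ_mul_mlynarP n hn n le_rfl
  have hs : ∑ k ∈ Finset.Icc 1 n, (k : ℝ) * (k + 1) * mlynarP n k =
      (∑ k ∈ Finset.Icc 1 n, (k : ℝ) ^ 2 * mlynarP n k) +
        ∑ k ∈ Finset.Icc 1 n, (k : ℝ) * mlynarP n k := by
    rw [← Finset.sum_add_distrib]
    exact Finset.sum_congr rfl fun k _ => by ring
  rw [hs, sub_self, mul_zero, zero_mul, zero_div, sub_zero] at h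
  linarith
end

section
/- For every real x ≥ 0, the cumulative distribution function of the scaled gain H_n = G_n/√n converges pointwise to the Rayleigh distribution with scale parameter 1: lim_{n→∞} ∑_{i=1}^{min(⌊x√n⌋, n)} p_{i,n} = 1 − exp(−x²/2). -/
open Finset Real Filter

theorem prod_range_one_sub_div_eq_factorial {n : ℕ} (hn : 0 < n) {k : ℕ} (hk : k ≤ n) :
    ∏ j ∈ Finset.range k, (1 - (j : ℝ) / n) =
      (Nat.factorial n : ℝ) / ((n : ℝ) ^ k * (Nat.factorial (n - k))) := by
  have hn' : (n : ℝ) ≠ 0 := by positivity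
  induction k with
  | zero => simp [Nat.factorial_ne_zero]
  | succ k ih =>
    have hsub : n - k = (n - (k + 1)) + 1 := by omega
    have hcast : ((n - (k + 1) : ℕ) : ℝ) + 1 = n - k := by
      rw [Nat.cast_sub hk]
      push_cast
      ring
    have hpos : (n : ℝ) - k ≠ 0 := by
      rw [← hcast]
      positivity
    rw [Finset.prod_range_succ, ih (by omega), hsub, Nat.factorial_succ]
    push_cast
    rw [hcast]
    have hfac : (Nat.factorial (n - (k + 1)) : ℝ) ≠ 0 := by positivity
    field_simp
    ring

theorem mlynarP_eq_div_mul_prod {n : ℕ} (hn : 0 < n) {k : ℕ} (hk : k ≤ n) :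
    mlynarP n k = (k : ℝ) / n * ∏ j ∈ Finset.range k, (1 - (j : ℝ) / n) := by
  have hn' : (n : ℝ) ≠ 0 := by positivity
  rw [prod_range_one_sub_div_eq_factorial hn hk, mlynarP, ← Nat.mul_factorial_pred hn.ne']
  push_cast
  field_simp

theorem sum_Icc_mlynarP {n : ℕ} (hn : 0 < n) {m : ℕ} (hm : m ≤ n) :
    ∑ i ∈ Finset.Icc 1 m, mlynarP n i =
      1 - ∏ j ∈ Finset.range (m + 1), (1 - (j : ℝ) / n) := by
  induction m with
  | zero => simp
  | succ m ih =>
    rw [Finset.sum_Icc_succ_top (by omega), ih (by omega), mlynarP_eq_div_mul_prod hn hm,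
      Finset.prod_range_succ _ (m + 1)]
    ring

theorem sum_range_succ_cast_div (n : ℝ) (m : ℕ) :
    ∑ j ∈ Finset.range (m + 1), (j : ℝ) / n = m * (m + 1) / (2 * n) := by
  rw [← Finset.sum_div, mul_comm 2 n, ← div_div, div_right_comm]
  congr 1
  induction m with
  | zero => simp
  | succ m ih =>
    rw [Finset.sum_range_succ, ih]
    push_cast
    ring

theorem prod_range_one_sub_div_le_exp {n m : ℕ} (hm : m ≤ n) :
    ∏ j ∈ Finset.range (m + 1), (1 - (j : ℝ) / n) ≤
      Real.exp (-((m : ℝ) * (m + 1) / (2 * n))) := by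
  rw [← sum_range_succ_cast_div, ← Finset.sum_neg_distrib, Real.exp_sum]
  refine Finset.prod_le_prod (fun j hj => ?_) (fun j _ => Real.one_sub_le_exp_neg _)
  have hj' : (j : ℝ) ≤ n := by
    exact_mod_cast (Nat.lt_succ_iff.mp (Finset.mem_range.mp hj)).trans hm
  exact sub_nonneg.mpr (div_le_one_of_le₀ hj' (Nat.cast_nonneg n))

theorem exp_le_prod_range_one_sub_div {n m : ℕ} (hm : m < n) :
    Real.exp (-((m : ℝ) * (m + 1) / (2 * n)) / (1 - (m : ℝ) / n)) ≤
      ∏ j ∈ Finset.range (m + 1), (1 - (j : ℝ) / n) := by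
  have hn : (0 : ℝ) < n := by exact_mod_cast (Nat.zero_le m).trans_lt hm
  have hm' : 0 < 1 - (m : ℝ) / n := by
    rw [sub_pos, div_lt_one hn]
    exact_mod_cast hm
  rw [← sum_range_succ_cast_div, ← Finset.sum_neg_distrib, Finset.sum_div, Real.exp_sum]
  refine Finset.prod_le_prod (fun j _ => (Real.exp_pos _).le) (fun j hj => ?_)
  have hjm : (j : ℝ) / n ≤ m / n := by
    have : (j : ℝ) ≤ m := by exact_mod_cast Nat.lt_succ_iff.mp (Finset.mem_range.mp hj)
    gcongr
  have hj0 : 0 ≤ (j : ℝ) / n := by positivity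
  have hj1 : 0 < 1 - (j : ℝ) / n := by linarith
  rw [← Real.le_log_iff_exp_le hj1]
  refine le_trans ?_ (Real.one_sub_inv_le_log_of_pos hj1)
  have hid : 1 - (1 - (j : ℝ) / n)⁻¹ = -((j : ℝ) / n / (1 - (j : ℝ) / n)) := by
    generalize (j : ℝ) / n = t at hj1
    field_simp
    ring
  rw [hid, neg_div, neg_le_neg_iff]
  exact div_le_div_of_nonneg_left hj0 hm' (by linarith)

theorem tendsto_floor_mul_sqrt_div_sqrt {x : ℝ} (hx : 0 ≤ x) :
    Tendsto (fun n : ℕ => (Nat.floor (x * Real.sqrt n) : ℝ) / Real.sqrt n) atTop (nhds x) :=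
  (tendsto_nat_floor_mul_div_atTop hx).comp
    (Real.tendsto_sqrt_atTop.comp tendsto_natCast_atTop_atTop)

theorem tendsto_inv_sqrt_natCast :
    Tendsto (fun n : ℕ => (Real.sqrt n)⁻¹) atTop (nhds 0) :=
  tendsto_inv_atTop_zero.comp (Real.tendsto_sqrt_atTop.comp tendsto_natCast_atTop_atTop)

theorem tendsto_floor_mul_sqrt_div {x : ℝ} (hx : 0 ≤ x) :
    Tendsto (fun n : ℕ => (Nat.floor (x * Real.sqrt n) : ℝ) / n) atTop (nhds 0) := by
  have h := (tendsto_floor_mul_sqrt_div_sqrt hx).mul tendsto_inv_sqrt_natCast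
  rw [mul_zero] at h
  refine h.congr fun n => ?_
  rw [← div_eq_mul_inv, div_div, Real.mul_self_sqrt (Nat.cast_nonneg n)]

theorem tendsto_floor_mul_sqrt_mul_succ_div {x : ℝ} (hx : 0 ≤ x) :
    Tendsto (fun n : ℕ => (Nat.floor (x * Real.sqrt n) : ℝ) *
      (Nat.floor (x * Real.sqrt n) + 1) / (2 * n)) atTop (nhds (x ^ 2 / 2)) := by
  have h := (((tendsto_floor_mul_sqrt_div_sqrt hx).pow 2).add
    (tendsto_floor_mul_sqrt_div hx)).div_const 2
  rw [add_zero] at h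
  refine h.congr fun n => ?_
  rw [div_pow, Real.sq_sqrt (Nat.cast_nonneg n), ← add_div, div_div, mul_comm (n : ℝ) 2]
  ring

theorem mlynar_weak_convergence_to_rayleigh (x : ℝ) (hx : 0 ≤ x) :
    Tendsto (fun n : ℕ =>
        ∑ i ∈ Finset.Icc 1 (min (Nat.floor (x * Real.sqrt n)) n), mlynarP n i)
      atTop (nhds (1 - Real.exp (-x ^ 2 / 2))) := by
  have hlt : ∀ᶠ n : ℕ in atTop, 0 < n ∧ Nat.floor (x * Real.sqrt n) < n := by
    filter_upwards [eventually_gt_atTop 0,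
      (tendsto_floor_mul_sqrt_div hx).eventually_lt_const one_pos] with n hn h
    refine ⟨hn, ?_⟩
    rw [div_lt_one (by positivity)] at h
    exact_mod_cast h
  have hsq := (tendsto_floor_mul_sqrt_mul_succ_div hx).neg
  have hupper := (Real.continuous_exp.tendsto _).comp hsq
  have hden := (tendsto_floor_mul_sqrt_div hx).const_sub 1
  rw [sub_zero] at hden
  have hlower := (Real.continuous_exp.tendsto _).comp (hsq.div hden one_ne_zero)
  rw [div_one] at hlower
  have hprod := tendsto_of_tendsto_of_tendsto_of_le_of_le' hlower hupper
    (hlt.mono fun n hn => exp_le_prod_range_one_sub_div hn.2)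
    (hlt.mono fun n hn => prod_range_one_sub_div_le_exp hn.2.le)
  rw [neg_div]
  refine (hprod.const_sub 1).congr' (hlt.mono fun n hn => ?_)
  dsimp only
  rw [min_eq_left hn.2.le, sum_Icc_mlynarP hn.1 hn.2.le]
end

section
/- For every real x > 0, lim_{n→∞} ( ln Γ(n) − x√n · ln n − ln Γ(n − x√n) ) = −x²/2, where Γ is the real Gamma function (and n − x√n > 0 for all sufficiently large n). -/
open Real Filter

/-- `log Γ` is differentiable on the positive half-line. -/
theorem differentiableAt_log_Gamma {y : ℝ} (hy : 0 < y) :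
    DifferentiableAt ℝ (Real.log ∘ Real.Gamma) y :=
  (Real.differentiableAt_Gamma fun m h => by
    have : (0 : ℝ) ≤ m := m.cast_nonneg
    linarith).log (Real.Gamma_pos_of_pos hy).ne'

theorem log_Gamma_add_one {y : ℝ} (hy : 0 < y) :
    (Real.log ∘ Real.Gamma) (y + 1) = Real.log y + (Real.log ∘ Real.Gamma) y := by
  simp only [Function.comp_apply]
  rw [Real.Gamma_add_one hy.ne', Real.log_mul hy.ne' (Real.Gamma_pos_of_pos hy).ne']

theorem deriv_log_Gamma_le_log {y : ℝ} (hy : 0 < y) :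
    deriv (Real.log ∘ Real.Gamma) y ≤ Real.log y := by
  have h := Real.convexOn_log_Gamma.deriv_le_slope (x := y) (y := y + 1) hy
    (by simp only [Set.mem_Ioi]; linarith) (by linarith) (differentiableAt_log_Gamma hy)
  rw [slope_def_field, log_Gamma_add_one hy] at h
  simpa using h

theorem log_sub_one_le_deriv_log_Gamma {y : ℝ} (hy : 1 < y) :
    Real.log (y - 1) ≤ deriv (Real.log ∘ Real.Gamma) y := by
  have hy' : 0 < y - 1 := by linarith
  have h := Real.convexOn_log_Gamma.slope_le_deriv (x := y - 1) (y := y) hy'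
    (by simp only [Set.mem_Ioi]; linarith) (by linarith)
    (differentiableAt_log_Gamma (by linarith))
  have h2 := log_Gamma_add_one hy'
  rw [sub_add_cancel] at h2
  rw [slope_def_field, h2] at h
  simpa using h

theorem hasDerivAt_mul_log_sub_self {y : ℝ} (hy : y ≠ 0) :
    HasDerivAt (fun t : ℝ => t * Real.log t - t) (Real.log y) y := by
  have h := (Real.hasDerivAt_mul_log hy).sub (hasDerivAt_id y)
  rw [add_sub_cancel_right] at h
  exact h

theorem log_Gamma_sub_le {a b : ℝ} (ha : 0 < a) (hab : a ≤ b) :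
    Real.log (Real.Gamma b) - Real.log (Real.Gamma a) ≤
      (b * Real.log b - b) - (a * Real.log a - a) := by
  have hd : ∀ y ∈ Set.Ioi (0 : ℝ), HasDerivAt
      (fun t => (Real.log ∘ Real.Gamma) t - (t * Real.log t - t))
      (deriv (Real.log ∘ Real.Gamma) y - Real.log y) y := fun y hy =>
    (differentiableAt_log_Gamma hy).hasDerivAt.sub (hasDerivAt_mul_log_sub_self (ne_of_gt hy))
  have h := antitoneOn_of_deriv_nonpos (convex_Ioi (0 : ℝ))
    (fun y hy => (hd y hy).continuousAt.continuousWithinAt)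
    (fun y hy => (hd y (interior_subset hy)).differentiableAt.differentiableWithinAt)
    (fun y hy => by
      rw [(hd y (interior_subset hy)).deriv]
      exact sub_nonpos.2 (deriv_log_Gamma_le_log (interior_subset hy)))
  have := h (Set.mem_Ioi.2 ha) (Set.mem_Ioi.2 (ha.trans_le hab)) hab
  simp only [Function.comp_apply] at this
  linarith

theorem le_log_Gamma_sub {a b : ℝ} (ha : 1 < a) (hab : a ≤ b) :
    ((b - 1) * Real.log (b - 1) - (b - 1)) - ((a - 1) * Real.log (a - 1) - (a - 1)) ≤
      Real.log (Real.Gamma b) - Real.log (Real.Gamma a) := by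
  have hd : ∀ y ∈ Set.Ioi (1 : ℝ), HasDerivAt
      (fun t => (Real.log ∘ Real.Gamma) t - ((t - 1) * Real.log (t - 1) - (t - 1)))
      (deriv (Real.log ∘ Real.Gamma) y - Real.log (y - 1)) y := fun y hy =>
    (differentiableAt_log_Gamma (zero_lt_one.trans hy)).hasDerivAt.sub
      ((hasDerivAt_mul_log_sub_self (sub_ne_zero.2 (ne_of_gt hy))).comp_sub_const y 1)
  have h := monotoneOn_of_deriv_nonneg (convex_Ioi (1 : ℝ))
    (fun y hy => (hd y hy).continuousAt.continuousWithinAt)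
    (fun y hy => (hd y (interior_subset hy)).differentiableAt.differentiableWithinAt)
    (fun y hy => by
      rw [(hd y (interior_subset hy)).deriv]
      exact sub_nonneg.2 (log_sub_one_le_deriv_log_Gamma (interior_subset hy)))
  have := h (Set.mem_Ioi.2 ha) (Set.mem_Ioi.2 (ha.trans_le hab)) hab
  simp only [Function.comp_apply] at this
  linarith

theorem abs_one_sub_mul_log_one_sub_le {s : ℝ} (hs : 0 ≤ s) (hs1 : s < 1) :
    |-s - (1 - s) * Real.log (1 - s) + s ^ 2 / 2| ≤ 3 / 2 * s ^ 3 := by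
  have h := Real.abs_log_sub_add_sum_range_le (x := s) (by rwa [abs_of_nonneg hs]) 2
  have hpos : 0 < 1 - s := by linarith
  rw [abs_of_nonneg hs, le_div_iff₀ hpos] at h
  norm_num [Finset.sum_range_succ] at h
  rw [← abs_of_pos hpos, ← abs_mul, abs_of_pos hpos, abs_le] at h
  have h3 : 0 ≤ s ^ 3 := by positivity
  rw [abs_le]
  constructor <;> nlinarith [h.1, h.2]

/-- Second-order expansion of the increments of `t ↦ t log t - t`. -/
theorem abs_mul_log_increment_le {a u : ℝ} (hu : 0 ≤ u) (hua : u < a) :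
    |(a * Real.log a - a) - ((a - u) * Real.log (a - u) - (a - u)) - u * Real.log a
      + u ^ 2 / (2 * a)| ≤ 3 / 2 * (u ^ 3 / a ^ 2) := by
  have ha : 0 < a := hu.trans_lt hua
  have h := abs_one_sub_mul_log_one_sub_le (div_nonneg hu ha.le) ((div_lt_one ha).2 hua)
  have hl : Real.log (1 - u / a) = Real.log (a - u) - Real.log a := by
    rw [← Real.log_div (sub_pos.2 hua).ne' ha.ne', sub_div, div_self ha.ne']
  rw [hl] at h
  have h' := mul_le_mul_of_nonneg_left h ha.le
  rw [← abs_of_pos ha, ← abs_mul, abs_of_pos ha] at h'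
  have e1 : a * (-(u / a) - (1 - u / a) * (Real.log (a - u) - Real.log a) + (u / a) ^ 2 / 2) =
      (a * Real.log a - a) - ((a - u) * Real.log (a - u) - (a - u)) - u * Real.log a
        + u ^ 2 / (2 * a) := by
    generalize Real.log (a - u) = p
    field_simp
    ring
  have e2 : a * (3 / 2 * (u / a) ^ 3) = 3 / 2 * (u ^ 3 / a ^ 2) := by field_simp
  rwa [e1, e2] at h'

theorem log_gamma_tail_limit (x : ℝ) (hx : 0 < x) :
    (∀ᶠ n : ℕ in atTop, 0 < (n : ℝ) - x * Real.sqrt n) ∧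
    Tendsto (fun n : ℕ =>
        Real.log (Real.Gamma n) - x * Real.sqrt n * Real.log n -
          Real.log (Real.Gamma ((n : ℝ) - x * Real.sqrt n)))
      atTop (nhds (-x ^ 2 / 2)) := by
  have hsqrt : Tendsto (fun n : ℕ => Real.sqrt n) atTop atTop :=
    Real.tendsto_sqrt_atTop.comp tendsto_natCast_atTop_atTop
  have hbig : ∀ᶠ n : ℕ in atTop, 1 + x * Real.sqrt n < n := by
    filter_upwards [hsqrt.eventually_gt_atTop (x + 1)] with n hn
    nlinarith [Real.sq_sqrt (Nat.cast_nonneg (α := ℝ) n)]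
  refine ⟨hbig.mono fun n hn => by linarith, ?_⟩
  have hinv : Tendsto (fun n : ℕ => (Real.sqrt n)⁻¹) atTop (nhds 0) :=
    tendsto_inv_atTop_zero.comp hsqrt
  have hratio : Tendsto (fun n : ℕ => x * Real.sqrt n / ((n : ℝ) - 1)) atTop (nhds 0) := by
    have : Tendsto (fun n : ℕ => x * (Real.sqrt n)⁻¹ / (1 - (Real.sqrt n)⁻¹ ^ 2))
        atTop (nhds (x * 0 / (1 - 0 ^ 2))) :=
      (hinv.const_mul x).div ((hinv.pow 2).const_sub 1) (by norm_num)
    rw [mul_zero, zero_div] at this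
    refine this.congr' ?_
    filter_upwards [eventually_gt_atTop 1] with n hn
    have hn' : (1 : ℝ) < n := by exact_mod_cast hn
    have hr : 0 < Real.sqrt n := Real.sqrt_pos.2 (by linarith)
    have hr2 := Real.sq_sqrt (Nat.cast_nonneg (α := ℝ) n)
    have h1 : (n : ℝ) - 1 ≠ 0 := by linarith
    have h2 : 1 - (Real.sqrt n)⁻¹ ^ 2 = ((n : ℝ) - 1) / Real.sqrt n ^ 2 := by
      rw [hr2, inv_pow, hr2]; field_simp
    rw [h2]
    field_simp
  have hsquare : Tendsto (fun n : ℕ => (x * Real.sqrt n) ^ 2 / ((n : ℝ) - 1))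
      atTop (nhds (x ^ 2)) := by
    have : Tendsto (fun n : ℕ => x ^ 2 + (x * Real.sqrt n / ((n : ℝ) - 1)) *
        (x * (Real.sqrt n)⁻¹)) atTop (nhds (x ^ 2 + 0 * (x * 0))) :=
      (hratio.mul (hinv.const_mul x)).const_add _
    rw [zero_mul, add_zero] at this
    refine this.congr' ?_
    filter_upwards [eventually_gt_atTop 1] with n hn
    have hn' : (1 : ℝ) < n := by exact_mod_cast hn
    have hr : 0 < Real.sqrt n := Real.sqrt_pos.2 (by linarith)
    have h1 : (n : ℝ) - 1 ≠ 0 := by linarith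
    rw [mul_pow, Real.sq_sqrt n.cast_nonneg]
    field_simp
    ring
  have hlower : Tendsto (fun n : ℕ => -((x * Real.sqrt n) ^ 2 / ((n : ℝ) - 1)) / 2
      - 3 / 2 * ((x * Real.sqrt n) ^ 2 / ((n : ℝ) - 1) * (x * Real.sqrt n / ((n : ℝ) - 1)))
      - x * Real.sqrt n / ((n : ℝ) - 1)) atTop (nhds (-x ^ 2 / 2)) := by
    simpa using ((hsquare.neg.div_const 2).sub
      ((hsquare.mul hratio).const_mul (3 / 2))).sub hratio
  have hupper : Tendsto (fun n : ℕ => -x ^ 2 / 2 + 3 / 2 * (x ^ 3 * (Real.sqrt n)⁻¹))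
      atTop (nhds (-x ^ 2 / 2)) := by
    simpa using ((hinv.const_mul (x ^ 3)).const_mul (3 / 2)).const_add (-x ^ 2 / 2)
  refine tendsto_of_tendsto_of_tendsto_of_le_of_le' hlower hupper ?_ ?_
  · filter_upwards [hbig] with n hn
    have hu : 0 ≤ x * Real.sqrt n := by positivity
    set u := x * Real.sqrt n
    have hn1 : 0 < (n : ℝ) - 1 := by linarith
    have h1 := le_log_Gamma_sub (a := n - u) (b := n) (by linarith) (by linarith)
    rw [sub_right_comm (n : ℝ) u 1] at h1
    have h2 := (abs_le.1 (abs_mul_log_increment_le hu (a := (n : ℝ) - 1) (by linarith))).1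
    have h3 : -(1 / ((n : ℝ) - 1)) ≤ Real.log (n - 1) - Real.log n := by
      have := Real.log_le_sub_one_of_pos (x := n / ((n : ℝ) - 1)) (div_pos (by linarith) hn1)
      rw [Real.log_div (by linarith) hn1.ne', div_sub_one hn1.ne'] at this
      rw [sub_sub_cancel] at this
      linarith
    have h4 := mul_le_mul_of_nonneg_left h3 hu
    have e1 : u ^ 2 / (2 * ((n : ℝ) - 1)) = u ^ 2 / ((n : ℝ) - 1) / 2 := by field_simp
    have e2 : u ^ 3 / ((n : ℝ) - 1) ^ 2 = u ^ 2 / ((n : ℝ) - 1) * (u / ((n : ℝ) - 1)) := by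
      field_simp
    have e3 : u * -(1 / ((n : ℝ) - 1)) = -(u / ((n : ℝ) - 1)) := by ring
    rw [e1, e2] at h2
    rw [e3] at h4
    linarith
  · filter_upwards [hbig] with n hn
    have hu : 0 ≤ x * Real.sqrt n := by positivity
    have hn0 : 0 < (n : ℝ) := by linarith
    have hr : 0 < Real.sqrt n := Real.sqrt_pos.2 hn0
    have hr2 := Real.sq_sqrt (Nat.cast_nonneg (α := ℝ) n)
    have h1 := log_Gamma_sub_le (a := n - x * Real.sqrt n) (b := n) (by linarith) (by linarith)
    have h2 := (abs_le.1 (abs_mul_log_increment_le hu (a := (n : ℝ)) (by linarith))).2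
    have e1 : (x * Real.sqrt n) ^ 2 / (2 * (n : ℝ)) = x ^ 2 / 2 := by
      rw [mul_pow, hr2]; field_simp
    have e2 : (x * Real.sqrt n) ^ 3 / (n : ℝ) ^ 2 = x ^ 3 * (Real.sqrt n)⁻¹ := by
      rw [← hr2, Real.sqrt_sq hr.le]; field_simp
    rw [e1, e2] at h2
    linarith
end

section
/- For every natural number n ≥ 1 and every k with 2 ≤ k ≤ n: p_{k,n} > p_{k-1,n} if and only if k² − k < n; and p_{k,n} = p_{k-1,n} if and only if k² − k = n. In particular, the probability mass function p_{·,n} is unimodal. -/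
open Finset Real Filter

theorem mlynarP_succ_sub (n j : ℕ) (hj : j + 1 ≤ n) :
    ∃ c : ℝ, 0 < c ∧ mlynarP n (j + 1) - mlynarP n j = c * ((n : ℝ) - ((j + 1) * j : ℕ)) := by
  obtain ⟨d, rfl⟩ := Nat.exists_eq_add_of_le hj
  have h1 : j + 1 + d - (j + 1) = d := by omega
  have h2 : j + 1 + d - j = d + 1 := by omega
  have hn : (0 : ℝ) < ((j + 1 + d : ℕ) : ℝ) := by positivity
  refine ⟨(Nat.factorial (j + 1 + d - 1)) /
    (((j + 1 + d : ℕ) : ℝ) ^ (j + 1) * (Nat.factorial (d + 1))), by positivity, ?_⟩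
  unfold mlynarP
  rw [h1, h2, Nat.factorial_succ d]
  have hd : (0 : ℝ) < (d.factorial : ℝ) := by positivity
  push_cast at hn ⊢
  field_simp
  ring

theorem mlynarP_lt_succ_iff (n j : ℕ) (hj : j + 1 ≤ n) :
    mlynarP n j < mlynarP n (j + 1) ↔ (j + 1) * j < n := by
  obtain ⟨c, hc, h⟩ := mlynarP_succ_sub n j hj
  rw [← sub_pos, h, mul_pos_iff_of_pos_left hc, sub_pos, Nat.cast_lt]

theorem mlynarP_succ_eq_iff (n j : ℕ) (hj : j + 1 ≤ n) :
    mlynarP n (j + 1) = mlynarP n j ↔ (j + 1) * j = n := by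
  obtain ⟨c, hc, h⟩ := mlynarP_succ_sub n j hj
  rw [← sub_eq_zero, h, mul_eq_zero, or_iff_right hc.ne', sub_eq_zero, Nat.cast_inj, eq_comm]

theorem mlynarP_le_succ_iff (n j : ℕ) (hj : j + 1 ≤ n) :
    mlynarP n j ≤ mlynarP n (j + 1) ↔ (j + 1) * j ≤ n := by
  rw [le_iff_lt_or_eq, mlynarP_lt_succ_iff n j hj, eq_comm, mlynarP_succ_eq_iff n j hj,
    ← le_iff_lt_or_eq]

theorem mlynar_unimodal (n : ℕ) (hn : 1 ≤ n) :
    (∀ k : ℕ, 2 ≤ k → k ≤ n →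
        (mlynarP n k > mlynarP n (k - 1) ↔ k ^ 2 - k < n) ∧
        (mlynarP n k = mlynarP n (k - 1) ↔ k ^ 2 - k = n)) ∧
    ∃ m : ℕ, 1 ≤ m ∧ m ≤ n ∧
      (∀ j k : ℕ, 1 ≤ j → j ≤ k → k ≤ m → mlynarP n j ≤ mlynarP n k) ∧
      (∀ j k : ℕ, m ≤ j → j ≤ k → k ≤ n → mlynarP n k ≤ mlynarP n j) := by
  refine ⟨fun k hk hkn => ?_, ?_⟩
  · obtain ⟨j, rfl⟩ := Nat.exists_eq_add_of_le' (by omega : 1 ≤ k)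
    have h : (j + 1) ^ 2 - (j + 1) = (j + 1) * j := by
      rw [show (j + 1) ^ 2 = (j + 1) * j + (j + 1) by ring, Nat.add_sub_cancel]
    rw [h, Nat.add_sub_cancel]
    exact ⟨mlynarP_lt_succ_iff n j hkn, mlynarP_succ_eq_iff n j hkn⟩
  · let m := Nat.findGreatest (fun k => k * (k - 1) ≤ n) n
    have hm : m * (m - 1) ≤ n :=
      Nat.findGreatest_spec (P := fun k => k * (k - 1) ≤ n) hn (by simp)
    have hmn : m ≤ n := Nat.findGreatest_le n
    refine ⟨m, Nat.le_findGreatest hn (by simp), hmn, fun j k _ hjk => ?_, fun j k hmj hjk => ?_⟩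
    · induction k, hjk using Nat.le_induction with
      | base => exact fun _ => le_rfl
      | succ k _ ih =>
        intro hk
        refine (ih (by omega)).trans ((mlynarP_le_succ_iff n k (by omega)).2 ?_)
        exact (Nat.mul_le_mul hk (by omega)).trans hm
    · induction k, hjk using Nat.le_induction with
      | base => exact fun _ => le_rfl
      | succ k hjk ih =>
        intro hk
        refine le_trans (not_lt.1 fun hlt => ?_) (ih (by omega))
        have hle := ((mlynarP_lt_succ_iff n k hk).1 hlt).le
        exact Nat.findGreatest_is_greatest (P := fun k => k * (k - 1) ≤ n)
          (show m < k + 1 by omega) hk hle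
end

section
/- If n = (m−1)·m for some natural number m ≥ 2, then the Mlynar distribution with parameter n has two modes m−1 and m: p_{m-1,n} = p_{m,n}, and p_{m,n} ≥ p_{k,n} for every k with 1 ≤ k ≤ n. -/
open Finset Real Filter

theorem mlynarP_nonneg (n k : ℕ) : 0 ≤ mlynarP n k := by
  unfold mlynarP
  positivity

theorem mlynarP_succ_mul {n k : ℕ} (hk : k < n) :
    mlynarP n (k + 1) * (k * n) = mlynarP n k * ((k + 1) * (n - k)) := by
  obtain ⟨j, rfl⟩ := Nat.exists_eq_add_of_lt hk
  have h₁ : k + j + 1 - (k + 1) = j := by omega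
  have h₂ : k + j + 1 - k = j + 1 := by omega
  have hn : ((k + j + 1 : ℕ) : ℝ) ≠ 0 := by positivity
  have hj : (j : ℝ) + 1 ≠ 0 := by positivity
  have hf : (Nat.factorial j : ℝ) ≠ 0 := by positivity
  have hc : ((k + j + 1 : ℕ) : ℝ) - k = j + 1 := by push_cast; ring
  unfold mlynarP
  rw [h₁, h₂, hc, Nat.factorial_succ, Nat.cast_mul, Nat.cast_succ j, Nat.cast_succ k]
  field_simp
  ring

theorem mlynarP_le_succ {n k : ℕ} (hk : 0 < k) (h : k * (k + 1) ≤ n) :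
    mlynarP n k ≤ mlynarP n (k + 1) := by
  have hkn : k < n := by nlinarith
  have h' : (k : ℝ) * (k + 1) ≤ n := by exact_mod_cast h
  have hpos : (0 : ℝ) < k * n := by
    have : 0 < k * n := Nat.mul_pos hk (by omega)
    exact_mod_cast this
  refine le_of_mul_le_mul_right ?_ hpos
  rw [mlynarP_succ_mul hkn]
  exact mul_le_mul_of_nonneg_left (by nlinarith) (mlynarP_nonneg n k)

theorem mlynarP_succ_le {n k : ℕ} (hk : 0 < k) (hkn : k < n) (h : n ≤ k * (k + 1)) :
    mlynarP n (k + 1) ≤ mlynarP n k := by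
  have h' : (n : ℝ) ≤ k * (k + 1) := by exact_mod_cast h
  have hpos : (0 : ℝ) < k * n := by
    have : 0 < k * n := Nat.mul_pos hk (by omega)
    exact_mod_cast this
  refine le_of_mul_le_mul_right ?_ hpos
  rw [mlynarP_succ_mul hkn]
  exact mul_le_mul_of_nonneg_left (by nlinarith) (mlynarP_nonneg n k)

theorem mlynar_two_modes (m : ℕ) (hm : 2 ≤ m) (n : ℕ) (hn : n = (m - 1) * m) :
    mlynarP n (m - 1) = mlynarP n m ∧
    ∀ k : ℕ, 1 ≤ k → k ≤ n → mlynarP n k ≤ mlynarP n m := by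
  obtain ⟨a, rfl⟩ : ∃ a, m = a + 1 := ⟨m - 1, by omega⟩
  rw [Nat.add_sub_cancel] at hn ⊢
  have ha : 0 < a := by omega
  have han : a < n := by nlinarith
  refine ⟨le_antisymm (mlynarP_le_succ ha hn.ge) (mlynarP_succ_le ha han hn.le), ?_⟩
  intro k hk hkn
  rcases le_total k (a + 1) with hka | hka
  · induction hka using Nat.decreasingInduction with
    | self => exact le_rfl
    | of_succ j hj ih =>
      exact (mlynarP_le_succ hk (by rw [hn]; gcongr <;> omega)).trans
        (ih (by omega) (by omega))
  · induction k, hka using Nat.le_induction with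
    | base => exact le_rfl
    | succ j hj ih =>
      exact (mlynarP_succ_le (by omega) hkn (by rw [hn]; gcongr <;> omega)).trans
        (ih (by omega) (by omega))
end
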